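/- arXiv:2411.16564 — 6 statements merged into one kernel-verified Lean document; each statement's English description precedes it below -/
import Mathlib

section
/- Let M = (S, Act, P) be an MDP and rew : S → [0,∞] a reward function for M. The min-Bellman operator Φ_min of M with respect to rew is ω-continuous on the complete lattice of value functions: for every increasing ω-chain v_0 ≼ v_1 ≼ v_2 ≼ … of value functions, Φ_min(⨆_{n∈ℕ} v_n) = ⨆_{n∈ℕ} Φ_min(v_n). -/
open scoped ENNReal

noncomputable section

/-- A Markov decision process: countable state space `S`, finite action set `A`,
transition probability function `P` (values in `[0,1]`, represented in `ℝ≥0∞`)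
such that each `P s a ·` is a finitely supported full or null distribution,
and every state has at least one enabled action. -/
structure MDP where
  S : Type
  A : Type
  countableS : Countable S
  finiteA : Finite A
  P : S → A → S → ℝ≥0∞
  P_le_one : ∀ s a s', P s a s' ≤ 1
  finite_supp : ∀ s a, {s' | 0 < P s a s'}.Finite
  full_or_null : ∀ s a, (∑' s', P s a s') = 1 ∨ (∑' s', P s a s') = 0
  exists_enabled : ∀ s, ∃ a, (∑' s', P s a s') = 1

/-- Reward of a path: sum of the rewards of all its states. -/
def rewPath {σ : Type*} (rew : σ → ℝ≥0∞) (π : List σ) : ℝ≥0∞ := (π.map rew).sum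

/-- Reward of the last state of a path (zero for the empty sequence). -/
def lastRew {σ : Type*} (rew : σ → ℝ≥0∞) (π : List σ) : ℝ≥0∞ := π.getLast?.elim 0 rew

/-- Knaster–Tarski least fixed point of an endomap on a complete lattice. -/
def lfpOf {α : Type*} [CompleteLattice α] (Φ : α → α) : α := sInf {v | Φ v ≤ v}

namespace MDP

/-- The set of actions enabled in state `s`. -/
def Act (M : MDP) (s : M.S) : Set M.A := {a | (∑' s', M.P s a s') = 1}

/-- A scheduler assigns to every history (coded as the list of previously visited
states together with the current state; `𝔖 h s` is the choice for history `h ++ [s]`)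
an action enabled in the current state. -/
def IsSched (M : MDP) (𝔖 : List M.S → M.S → M.A) : Prop :=
  ∀ (h : List M.S) (s : M.S), 𝔖 h s ∈ M.Act s

/-- A scheduler is memoryless if its choice depends only on the last state. -/
def Memoryless (M : MDP) (𝔖 : List M.S → M.S → M.A) : Prop :=
  ∀ (h₁ h₂ : List M.S) (s : M.S), 𝔖 h₁ s = 𝔖 h₂ s

/-- The type of schedulers of `M`. -/
def Scheds (M : MDP) : Type := {𝔖 : List M.S → M.S → M.A // M.IsSched 𝔖}

/-- A path is a finite nonempty sequence of states such that each step is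
possible via some enabled action. -/
def IsPath (M : MDP) : List M.S → Prop
  | [] => False
  | [_] => True
  | s :: s' :: rest => (∃ a ∈ M.Act s, 0 < M.P s a s') ∧ IsPath M (s' :: rest)

/-- Probability of traversing the given remaining path, where `pref` is the
history of previously visited states. -/
def probAux (M : MDP) (𝔖 : List M.S → M.S → M.A) : List M.S → List M.S → ℝ≥0∞
  | _, [] => 1
  | _, [_] => 1
  | pref, s :: s' :: rest =>
      M.P s (𝔖 pref s) s' * probAux M 𝔖 (pref ++ [s]) (s' :: rest)

/-- The probability of a path under scheduler `𝔖` (the empty product is `1`). -/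
def pathProb (M : MDP) (𝔖 : List M.S → M.S → M.A) (π : List M.S) : ℝ≥0∞ :=
  M.probAux 𝔖 [] π

/-- Paths of length exactly `n` (that is, `n` steps and `n + 1` states) starting in `s`. -/
def PathsEq (M : MDP) (n : ℕ) (s : M.S) : Set (List M.S) :=
  {π | M.IsPath π ∧ π.head? = some s ∧ π.length = n + 1}

/-- Paths of length at most `n` starting in `s`. -/
def PathsLe (M : MDP) (n : ℕ) (s : M.S) : Set (List M.S) :=
  {π | M.IsPath π ∧ π.head? = some s ∧ π.length ≤ n + 1}

/-- All finite paths starting in `s`. -/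
def Paths (M : MDP) (s : M.S) : Set (List M.S) :=
  {π | M.IsPath π ∧ π.head? = some s}

/-- Expected reward from `s` after exactly `n` steps under scheduler `𝔖`. -/
def ERn (M : MDP) (rew : M.S → ℝ≥0∞) (𝔖 : List M.S → M.S → M.A) (n : ℕ) (s : M.S) :
    ℝ≥0∞ :=
  ∑' π : M.PathsEq n s, M.pathProb 𝔖 (π : List M.S) * rewPath rew (π : List M.S)

/-- Total expected reward from `s` under scheduler `𝔖`. -/
def ER (M : MDP) (rew : M.S → ℝ≥0∞) (𝔖 : List M.S → M.S → M.A) (s : M.S) : ℝ≥0∞ :=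
  ⨆ n : ℕ, M.ERn rew 𝔖 n s

/-- Minimal expected reward from `s` after exactly `n` steps. -/
def MinERn (M : MDP) (rew : M.S → ℝ≥0∞) (n : ℕ) (s : M.S) : ℝ≥0∞ :=
  ⨅ 𝔖 : M.Scheds, M.ERn rew 𝔖.1 n s

/-- Maximal expected reward from `s` after exactly `n` steps. -/
def MaxERn (M : MDP) (rew : M.S → ℝ≥0∞) (n : ℕ) (s : M.S) : ℝ≥0∞ :=
  ⨆ 𝔖 : M.Scheds, M.ERn rew 𝔖.1 n s

/-- Minimal (total) expected reward from `s`. -/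
def MinER (M : MDP) (rew : M.S → ℝ≥0∞) (s : M.S) : ℝ≥0∞ :=
  ⨅ 𝔖 : M.Scheds, M.ER rew 𝔖.1 s

/-- Maximal (total) expected reward from `s`. -/
def MaxER (M : MDP) (rew : M.S → ℝ≥0∞) (s : M.S) : ℝ≥0∞ :=
  ⨆ 𝔖 : M.Scheds, M.ER rew 𝔖.1 s

/-- The min-Bellman operator of `M` with respect to `rew`. -/
def bellmanMin (M : MDP) (rew : M.S → ℝ≥0∞) (v : M.S → ℝ≥0∞) : M.S → ℝ≥0∞ :=
  fun s => rew s + ⨅ a : M.Act s, ∑' s', M.P s a.1 s' * v s'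

/-- The max-Bellman operator of `M` with respect to `rew`. -/
def bellmanMax (M : MDP) (rew : M.S → ℝ≥0∞) (v : M.S → ℝ≥0∞) : M.S → ℝ≥0∞ :=
  fun s => rew s + ⨆ a : M.Act s, ∑' s', M.P s a.1 s' * v s'

end MDP

namespace ENNReal

/-- Monotone convergence for sums of nonnegative extended reals. -/
theorem tsum_iSup_of_monotone {α : Type*} {f : ℕ → α → ℝ≥0∞} (hf : Monotone f) :
    ∑' i, ⨆ n, f n i = ⨆ n, ∑' i, f n i := by
  simp_rw [ENNReal.tsum_eq_iSup_sum]
  rw [iSup_comm]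
  exact iSup_congr fun t => ENNReal.finsetSum_iSup_of_monotone fun i _ _ h => hf h i

end ENNReal

/-- The min-Bellman operator of an MDP `M` with respect to a reward
function `rew` is ω-continuous on the complete lattice of value functions: for every
increasing ω-chain `v₀ ≼ v₁ ≼ …` of value functions,
`Φmin (⨆ n, vₙ) = ⨆ n, Φmin vₙ`. -/
theorem bellmanMin_omegaContinuous (M : MDP) (rew : M.S → ℝ≥0∞)
    (v : ℕ → (M.S → ℝ≥0∞)) (hchain : Monotone v) :
    M.bellmanMin rew (⨆ n, v n) = ⨆ n, M.bellmanMin rew (v n) := by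
  funext s
  have := M.finiteA
  have mono (a : M.Act s) : Monotone fun n s' => M.P s a.1 s' * v n s' :=
    fun _ _ h s' => mul_le_mul_right (hchain h s') _
  simp only [MDP.bellmanMin, iSup_apply, ENNReal.mul_iSup]
  simp_rw [fun a : M.Act s => ENNReal.tsum_iSup_of_monotone (mono a)]
  rw [← ENNReal.add_iSup, iSup_iInf_of_monotone fun a _ _ h => ENNReal.tsum_le_tsum (mono a h)]
end
end

section
/- Let M = (S, Act, P) be an MDP and rew : S → [0,∞] a reward function for M. The max-Bellman operator Φ_max of M with respect to rew is ω-continuous on the complete lattice of value functions: for every increasing ω-chain v_0 ≼ v_1 ≼ v_2 ≼ … of value functions, Φ_max(⨆_{n∈ℕ} v_n) = ⨆_{n∈ℕ} Φ_max(v_n). -/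
open scoped ENNReal

noncomputable section

/-- Monotone convergence for sums in `ℝ≥0∞`. -/
theorem ENNReal.tsum_iSup_of_monotone_s1 {α ι : Type*} [Preorder ι] [IsDirectedOrder ι]
    {f : α → ι → ℝ≥0∞} (hf : ∀ a, Monotone (f a)) :
    ∑' a, ⨆ i, f a i = ⨆ i, ∑' a, f a i := by
  simp_rw [ENNReal.tsum_eq_iSup_sum, ENNReal.finsetSum_iSup_of_monotone hf]
  exact iSup_comm

/-- The max-Bellman operator of an MDP `M` with respect to a reward
function `rew` is ω-continuous on the complete lattice of value functions: for every
increasing ω-chain `v₀ ≼ v₁ ≼ …` of value functions,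
`Φmax (⨆ n, vₙ) = ⨆ n, Φmax vₙ`. -/
theorem bellmanMax_omegaContinuous (M : MDP) (rew : M.S → ℝ≥0∞)
    (v : ℕ → (M.S → ℝ≥0∞)) (hchain : Monotone v) :
    M.bellmanMax rew (⨆ n, v n) = ⨆ n, M.bellmanMax rew (v n) := by
  funext s
  have hsum (a : M.Act s) :
      ∑' s', M.P s a.1 s' * ⨆ n, v n s' = ⨆ n, ∑' s', M.P s a.1 s' * v n s' := by
    simp_rw [ENNReal.mul_iSup]
    exact ENNReal.tsum_iSup_of_monotone_s1 fun s' _ _ h => mul_le_mul_right (hchain h s') _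
  simp only [MDP.bellmanMax, iSup_apply, hsum]
  rw [iSup_comm, ENNReal.add_iSup]
end
end

section
/- Let M = (S, Act, P) be an MDP, rew : S → [0,∞] a reward function for M, and Φ_min the min-Bellman operator of M with respect to rew. For every n ∈ ℕ, the (n+1)-st fixed point iterate of Φ_min on the constant-zero value function equals the minimal expected reward after n steps: Φ_min^{n+1}(0) = λ s. MinER^{=n}(rew, s). -/
open scoped ENNReal

noncomputable section

namespace MDP

variable (M : MDP) (rew : M.S → ℝ≥0∞)

/-- The expected reward after `n` further steps from `s` with history `h`, computed by
recursion on `n`. -/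
def stepER (𝔖 : List M.S → M.S → M.A) : ℕ → List M.S → M.S → ℝ≥0∞
  | 0, _, s => rew s
  | n + 1, h, s => rew s + ∑' s', M.P s (𝔖 h s) s' * stepER 𝔖 n (h ++ [s]) s'

lemma pathsEq_zero (s : M.S) : M.PathsEq 0 s = {[s]} := by
  ext π
  rcases π with _ | ⟨t, _ | ⟨u, r⟩⟩ <;> simp [PathsEq, IsPath]

lemma tsum_pathsEq_succ (n : ℕ) (s : M.S) (f : List M.S → ℝ≥0∞)
    (hf : ∀ s' r, (¬ ∃ a ∈ M.Act s, 0 < M.P s a s') → f (s :: s' :: r) = 0) :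
    ∑' π : M.PathsEq (n + 1) s, f π = ∑' s', ∑' π : M.PathsEq n s', f (s :: π) := by
  have hinj : Function.Injective
      (fun p : (s' : M.S) × M.PathsEq n s' => s :: (p.2 : List M.S)) := by
    rintro ⟨s₁, π₁, h₁⟩ ⟨s₂, π₂, h₂⟩ h
    obtain rfl : π₁ = π₂ := by simpa using h
    obtain rfl : s₁ = s₂ := Option.some.inj (h₁.2.1.symm.trans h₂.2.1)
    rfl
  rw [← ENNReal.tsum_sigma (fun s' (π : M.PathsEq n s') => f (s :: (π : List M.S))),
    tsum_subtype, ← hinj.tsum_eq]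
  · refine tsum_congr ?_
    rintro ⟨s', π, hπ⟩
    rcases π with _ | ⟨t, r⟩
    · exact absurd hπ.1 (by simp [IsPath])
    · by_cases hs : ∃ a ∈ M.Act s, 0 < M.P s a t
      · have hmem : s :: t :: r ∈ M.PathsEq (n + 1) s :=
          ⟨⟨hs, hπ.1⟩, rfl, by simpa using hπ.2.2⟩
        exact Set.indicator_of_mem hmem f
      · exact (Set.indicator_apply_eq_zero.2 fun _ => hf t r hs).trans (hf t r hs).symm
  · intro π hπ
    have hmem := Set.mem_of_indicator_ne_zero hπ
    rcases π with _ | ⟨t, _ | ⟨u, r⟩⟩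
    · exact absurd hmem.1 (by simp [IsPath])
    · exact absurd hmem.2.2 (by simp)
    · obtain rfl : t = s := by simpa using hmem.2.1
      exact ⟨⟨u, u :: r, hmem.1.2, rfl, by simpa using hmem.2.2⟩, rfl⟩

lemma tsum_probAux_mul_add_rewPath {𝔖 : List M.S → M.S → M.A} (h𝔖 : M.IsSched 𝔖) (n : ℕ)
    (h : List M.S) (s : M.S) (c : ℝ≥0∞) :
    ∑' π : M.PathsEq n s, M.probAux 𝔖 h π * (c + rewPath rew (π : List M.S)) =
      c + M.stepER rew 𝔖 n h s := by
  induction n generalizing h s c with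
  | zero =>
    rw [pathsEq_zero,
      tsum_singleton [s] (fun π : List M.S => M.probAux 𝔖 h π * (c + rewPath rew π))]
    simp [probAux, rewPath, stepER]
  | succ n ih =>
    rw [tsum_pathsEq_succ M n s
      (fun π : List M.S => M.probAux 𝔖 h π * (c + rewPath rew π))]
    · have key : ∀ s', ∑' π : M.PathsEq n s',
          M.probAux 𝔖 h (s :: (π : List M.S)) * (c + rewPath rew (s :: (π : List M.S))) =
          M.P s (𝔖 h s) s' * (c + rew s) +
            M.P s (𝔖 h s) s' * M.stepER rew 𝔖 n (h ++ [s]) s' := by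
        intro s'
        rw [← mul_add, ← ih, ← ENNReal.tsum_mul_left]
        refine tsum_congr ?_
        rintro ⟨π, hπ⟩
        rcases π with _ | ⟨t, r⟩
        · exact absurd hπ.1 (by simp [IsPath])
        · obtain rfl : t = s' := by simpa using hπ.2.1
          simp [probAux, rewPath, mul_assoc, add_assoc]
      have hsum : ∑' s', M.P s (𝔖 h s) s' = 1 := h𝔖 h s
      rw [tsum_congr key, ENNReal.tsum_add, ENNReal.tsum_mul_right, hsum, one_mul, add_assoc]
      rfl
    · intro s' r hs
      have hP : M.P s (𝔖 h s) s' = 0 := by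
        by_contra hne
        exact hs ⟨_, h𝔖 h s, pos_iff_ne_zero.2 hne⟩
      simp [probAux, hP]

lemma ERn_eq_stepER {𝔖 : List M.S → M.S → M.A} (h𝔖 : M.IsSched 𝔖) (n : ℕ) (s : M.S) :
    M.ERn rew 𝔖 n s = M.stepER rew 𝔖 n [] s := by
  simpa [ERn, pathProb] using M.tsum_probAux_mul_add_rewPath rew h𝔖 n [] s 0

lemma bellmanMin_bot (s : M.S) : M.bellmanMin rew ⊥ s = rew s := by
  obtain ⟨a, ha⟩ := M.exists_enabled s
  have : Nonempty (M.Act s) := ⟨⟨a, ha⟩⟩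
  simp [bellmanMin]

lemma bellmanMin_iterate_le_stepER {𝔖 : List M.S → M.S → M.A} (h𝔖 : M.IsSched 𝔖) (n : ℕ)
    (h : List M.S) (s : M.S) :
    (M.bellmanMin rew)^[n + 1] ⊥ s ≤ M.stepER rew 𝔖 n h s := by
  induction n generalizing h s with
  | zero => exact (M.bellmanMin_bot rew s).le
  | succ n ih =>
    rw [Function.iterate_succ_apply']
    exact add_le_add_right ((iInf_le _ ⟨𝔖 h s, h𝔖 h s⟩).trans
      (ENNReal.tsum_le_tsum fun s' => mul_le_mul_right (ih _ s') _)) _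

lemma exists_act_eq_bellmanMin (v : M.S → ℝ≥0∞) (s : M.S) :
    ∃ a ∈ M.Act s, rew s + ∑' s', M.P s a s' * v s' = M.bellmanMin rew v s := by
  obtain ⟨a₀, ha₀⟩ := M.exists_enabled s
  have : Nonempty (M.Act s) := ⟨⟨a₀, ha₀⟩⟩
  have := M.finiteA
  obtain ⟨a, ha⟩ := exists_eq_ciInf_of_finite (f := fun a : M.Act s => ∑' s', M.P s a.1 s' * v s')
  exact ⟨a, a.2, congrArg (rew s + ·) ha⟩

lemma exists_sched_stepER_eq (N : ℕ) :
    ∃ 𝔖, M.IsSched 𝔖 ∧ ∀ n h s, h.length + n = N →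
      M.stepER rew 𝔖 n h s = (M.bellmanMin rew)^[n + 1] ⊥ s := by
  choose opt hopt hmin using M.exists_act_eq_bellmanMin rew
  refine ⟨fun h s => opt ((M.bellmanMin rew)^[N - h.length] ⊥) s, fun h s => hopt _ s, ?_⟩
  intro n
  induction n with
  | zero => exact fun h s _ => (M.bellmanMin_bot rew s).symm
  | succ n ih =>
    intro h s hN
    have hlen : N - h.length = n + 1 := by omega
    rw [Function.iterate_succ_apply', ← hmin, stepER, hlen]
    congr 1
    refine tsum_congr fun s' => ?_
    rw [ih (h ++ [s]) s' (by simp; omega)]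

end MDP

/-- For every `n`, the `(n+1)`-st fixed point iterate of the
min-Bellman operator on the constant-zero value function equals the minimal expected
reward after `n` steps: `Φmin^[n+1] 0 = fun s => MinER⁼ⁿ(rew, s)`. -/
theorem bellmanMin_iterate_eq_MinERn (M : MDP) (rew : M.S → ℝ≥0∞) (n : ℕ) :
    (M.bellmanMin rew)^[n + 1] ⊥ = fun s => M.MinERn rew n s := by
  funext s
  refine le_antisymm (le_iInf fun 𝔖 => ?_) ?_
  · rw [M.ERn_eq_stepER rew 𝔖.2]
    exact M.bellmanMin_iterate_le_stepER rew 𝔖.2 n [] s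
  · obtain ⟨𝔖, h𝔖, heq⟩ := M.exists_sched_stepER_eq rew n
    rw [← heq n [] s (by simp), ← M.ERn_eq_stepER rew h𝔖]
    exact iInf_le (fun 𝔖 : M.Scheds => M.ERn rew 𝔖.1 n s) ⟨𝔖, h𝔖⟩
end
end

section
/- Let M = (S, Act, P) be an MDP, rew : S → [0,∞] a reward function for M, and Φ_max the max-Bellman operator of M with respect to rew. For every n ∈ ℕ, the (n+1)-st fixed point iterate of Φ_max on the constant-zero value function equals the maximal expected reward after n steps: Φ_max^{n+1}(0) = λ s. MaxER^{=n}(rew, s). -/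
open scoped ENNReal

noncomputable section

namespace MDP

/-- The scheduler that behaves like `𝔖` after the state `s` has already been visited. -/
def shiftSched {M : MDP} (s : M.S) (𝔖 : List M.S → M.S → M.A) : List M.S → M.S → M.A :=
  fun h t => 𝔖 (s :: h) t

theorem IsSched.shiftSched {M : MDP} {𝔖 : List M.S → M.S → M.A} (h𝔖 : M.IsSched 𝔖) (s : M.S) :
    M.IsSched (shiftSched s 𝔖) :=
  fun h t => h𝔖 (s :: h) t

theorem probAux_cons (M : MDP) (𝔖 : List M.S → M.S → M.A) (s : M.S) (pref π : List M.S) :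
    M.probAux 𝔖 (s :: pref) π = M.probAux (shiftSched s 𝔖) pref π := by
  induction π generalizing pref with
  | nil => simp [probAux]
  | cons t π ih =>
    cases π with
    | nil => simp [probAux]
    | cons t' π => simp only [probAux, List.cons_append, ih, shiftSched]

theorem pathProb_cons_cons (M : MDP) (𝔖 : List M.S → M.S → M.A) (s s' : M.S) (π : List M.S) :
    M.pathProb 𝔖 (s :: s' :: π) =
      M.P s (𝔖 [] s) s' * M.pathProb (shiftSched s 𝔖) (s' :: π) := by
  simp [pathProb, probAux, probAux_cons]

theorem mem_PathsEq_zero {M : MDP} {s : M.S} {π : List M.S} : π ∈ M.PathsEq 0 s ↔ π = [s] := by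
  constructor
  · rintro ⟨-, hhead, hlen⟩
    obtain ⟨t, rfl⟩ := List.length_eq_one_iff.mp hlen
    simpa using hhead
  · rintro rfl
    simp [PathsEq, IsPath]

theorem tsum_PathsEq_zero (M : MDP) (s : M.S) (f : List M.S → ℝ≥0∞) :
    ∑' π : M.PathsEq 0 s, f π = f [s] := by
  rw [show M.PathsEq 0 s = {[s]} from Set.ext fun _ => mem_PathsEq_zero, tsum_singleton]

/-- The states reachable from `s` in one step. -/
def Succ (M : MDP) (s : M.S) : Set M.S := {s' | ∃ a ∈ M.Act s, 0 < M.P s a s'}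

theorem cons_mem_PathsEq_succ {M : MDP} {n : ℕ} {s s' : M.S} {π : List M.S}
    (hs' : s' ∈ M.Succ s) (hπ : π ∈ M.PathsEq n s') : s :: π ∈ M.PathsEq (n + 1) s := by
  obtain ⟨hpath, hhead, hlen⟩ := hπ
  cases π with
  | nil => simp at hhead
  | cons t π =>
    obtain rfl : t = s' := by simpa using hhead
    exact ⟨⟨hs', hpath⟩, rfl, by simpa using hlen⟩

/-- Paths with `n + 1` steps decompose into a first step and a path with `n` steps. -/
def pathsEqSuccEquiv (M : MDP) (n : ℕ) (s : M.S) :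
    (Σ s' : M.Succ s, M.PathsEq n s') ≃ M.PathsEq (n + 1) s :=
  Equiv.ofBijective (fun p => ⟨s :: p.2, cons_mem_PathsEq_succ p.1.2 p.2.2⟩) <| by
    constructor
    · rintro ⟨⟨t, ht⟩, π, hπ⟩ ⟨⟨t', ht'⟩, π', hπ'⟩ h
      obtain rfl : π = π' := by simpa using h
      obtain rfl : t = t' := Option.some.inj (hπ.2.1.symm.trans hπ'.2.1)
      rfl
    · rintro ⟨π, hpath, hhead, hlen⟩
      match π with
      | [] => simp at hhead
      | [_] => simp at hlen
      | t :: s' :: π =>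
        obtain rfl : t = s := by simpa using hhead
        exact ⟨⟨⟨s', hpath.1⟩, s' :: π, hpath.2, rfl, by simpa using hlen⟩, rfl⟩

theorem tsum_PathsEq_succ {M : MDP} {𝔖 : List M.S → M.S → M.A} (h𝔖 : M.IsSched 𝔖) (n : ℕ)
    (s : M.S) (f : List M.S → ℝ≥0∞) :
    ∑' π : M.PathsEq (n + 1) s, M.pathProb 𝔖 π * f π =
      ∑' s', M.P s (𝔖 [] s) s' *
        ∑' π : M.PathsEq n s', M.pathProb (shiftSched s 𝔖) π * f (s :: π) := by
  rw [← (pathsEqSuccEquiv M n s).tsum_eq, ENNReal.tsum_sigma',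
    ← tsum_subtype_eq_of_support_subset (s := M.Succ s)]
  · refine tsum_congr fun s' => ?_
    rw [← ENNReal.tsum_mul_left]
    refine tsum_congr fun π => ?_
    obtain ⟨π, -, hhead, -⟩ := π
    cases π with
    | nil => simp at hhead
    | cons t π =>
      obtain rfl : t = s' := by simpa using hhead
      rw [← mul_assoc, ← pathProb_cons_cons]
      rfl
  · intro s' hs'
    exact ⟨𝔖 [] s, h𝔖 [] s, pos_iff_ne_zero.mpr (left_ne_zero_of_mul hs')⟩

theorem tsum_pathProb {M : MDP} {𝔖 : List M.S → M.S → M.A} (h𝔖 : M.IsSched 𝔖) (n : ℕ)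
    (s : M.S) : ∑' π : M.PathsEq n s, M.pathProb 𝔖 π = 1 := by
  induction n generalizing 𝔖 s with
  | zero => rw [tsum_PathsEq_zero M s (M.pathProb 𝔖), pathProb, probAux]
  | succ n ih =>
    have h := tsum_PathsEq_succ h𝔖 n s fun _ => 1
    simp only [mul_one, ih (h𝔖.shiftSched s)] at h
    exact h.trans (h𝔖 [] s)

theorem ERn_zero (M : MDP) (rew : M.S → ℝ≥0∞) (𝔖 : List M.S → M.S → M.A) (s : M.S) :
    M.ERn rew 𝔖 0 s = rew s := by
  rw [ERn, tsum_PathsEq_zero M s fun π => M.pathProb 𝔖 π * rewPath rew π]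
  simp [pathProb, probAux, rewPath]

theorem ERn_succ {M : MDP} (rew : M.S → ℝ≥0∞) {𝔖 : List M.S → M.S → M.A} (h𝔖 : M.IsSched 𝔖)
    (n : ℕ) (s : M.S) :
    M.ERn rew 𝔖 (n + 1) s =
      rew s + ∑' s', M.P s (𝔖 [] s) s' * M.ERn rew (shiftSched s 𝔖) n s' := by
  have hsum : ∑' s', M.P s (𝔖 [] s) s' = 1 := h𝔖 [] s
  rw [ERn, tsum_PathsEq_succ h𝔖 n s (rewPath rew)]
  simp only [rewPath, List.map_cons, List.sum_cons, mul_add, ENNReal.tsum_add,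
    ENNReal.tsum_mul_right, tsum_pathProb (h𝔖.shiftSched s), hsum, one_mul, ERn]

theorem bellmanMax_bot (M : MDP) (rew : M.S → ℝ≥0∞) : M.bellmanMax rew ⊥ = rew := by
  funext s
  simp [bellmanMax]

theorem ERn_le_bellmanMax_iterate {M : MDP} (rew : M.S → ℝ≥0∞) {𝔖 : List M.S → M.S → M.A}
    (h𝔖 : M.IsSched 𝔖) (n : ℕ) (s : M.S) :
    M.ERn rew 𝔖 n s ≤ (M.bellmanMax rew)^[n + 1] ⊥ s := by
  induction n generalizing 𝔖 s with
  | zero => simp [ERn_zero, bellmanMax_bot]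
  | succ n ih =>
    rw [ERn_succ rew h𝔖, Function.iterate_succ_apply']
    refine add_le_add le_rfl (le_iSup_of_le ⟨𝔖 [] s, h𝔖 [] s⟩ ?_)
    exact ENNReal.tsum_le_tsum fun s' => mul_le_mul_right (ih (h𝔖.shiftSched s) s') _

theorem exists_bellmanMax_eq (M : MDP) (rew v : M.S → ℝ≥0∞) (s : M.S) :
    ∃ a ∈ M.Act s, M.bellmanMax rew v s = rew s + ∑' s', M.P s a s' * v s' := by
  have := M.finiteA
  obtain ⟨a₀, ha₀⟩ := M.exists_enabled s
  have : Nonempty (M.Act s) := ⟨⟨a₀, ha₀⟩⟩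
  obtain ⟨a, ha⟩ := exists_eq_ciSup_of_finite (f := fun a : M.Act s => ∑' s', M.P s a.1 s' * v s')
  exact ⟨a, a.2, by rw [bellmanMax, ← ha]⟩

theorem exists_isSched_ERn_eq_bellmanMax_iterate (M : MDP) (rew : M.S → ℝ≥0∞) (n : ℕ) :
    ∃ 𝔖, M.IsSched 𝔖 ∧ ∀ s, M.ERn rew 𝔖 n s = (M.bellmanMax rew)^[n + 1] ⊥ s := by
  induction n with
  | zero =>
    choose a ha using M.exists_enabled
    exact ⟨fun _ => a, fun _ => ha, fun s => by simp [ERn_zero, bellmanMax_bot]⟩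
  | succ n ih =>
    obtain ⟨𝔖, h𝔖, hopt⟩ := ih
    choose a ha hmax using M.exists_bellmanMax_eq rew ((M.bellmanMax rew)^[n + 1] ⊥)
    let 𝔗 : List M.S → M.S → M.A := fun h t => h.casesOn (a t) fun _ h' => 𝔖 h' t
    have h𝔗 : M.IsSched 𝔗 := by
      rintro (_ | ⟨_, h⟩) t
      exacts [ha t, h𝔖 h t]
    refine ⟨𝔗, h𝔗, fun s => ?_⟩
    have hshift : shiftSched s 𝔗 = 𝔖 := rfl
    rw [ERn_succ rew h𝔗, Function.iterate_succ_apply', hmax, hshift]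
    simp only [hopt, 𝔗]

end MDP

/-- For every `n`, the `(n+1)`-st fixed point iterate of the
max-Bellman operator on the constant-zero value function equals the maximal expected
reward after `n` steps: `Φmax^[n+1] 0 = fun s => MaxER⁼ⁿ(rew, s)`. -/
theorem bellmanMax_iterate_eq_MaxERn (M : MDP) (rew : M.S → ℝ≥0∞) (n : ℕ) :
    (M.bellmanMax rew)^[n + 1] ⊥ = fun s => M.MaxERn rew n s := by
  funext s
  obtain ⟨𝔖, h𝔖, hopt⟩ := M.exists_isSched_ERn_eq_bellmanMax_iterate rew n
  refine le_antisymm ?_ (iSup_le fun 𝔗 => MDP.ERn_le_bellmanMax_iterate rew 𝔗.2 n s)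
  rw [← hopt s]
  exact le_iSup (fun 𝔗 : M.Scheds => M.ERn rew 𝔗.1 n s) ⟨𝔖, h𝔖⟩
end
end

section
/- Let M = (S, Act, P) be an MDP, rew : S → [0,∞] a reward function for M, and 𝔖 a scheduler. For every n ∈ ℕ and every state s ∈ S, the expected reward after exactly n steps can be computed by summing, over all paths of length at most n starting in s, the path probability times the reward of the last state only: ER^{=n}_𝔖(rew, s) = ∑_{s_0…s_m ∈ Paths^{≤n}(s)} P^𝔖(s_0…s_m)·rew(s_m). -/
open scoped ENNReal

noncomputable section

theorem ENNReal.tsum_list {α : Type*} (f : List α → ℝ≥0∞) :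
    ∑' l, f l = f [] + ∑' a, ∑' l, f (a :: l) := by
  let e : Unit ⊕ (α × List α) ≃ List α :=
    { toFun := Sum.elim (fun _ => []) (fun p => p.1 :: p.2)
      invFun := fun l => match l with
        | [] => Sum.inl ()
        | a :: l => Sum.inr (a, l)
      left_inv := by rintro (_ | _) <;> rfl
      right_inv := by rintro (_ | _) <;> rfl }
  rw [← e.tsum_eq f, ENNReal.summable.tsum_sum ENNReal.summable, ← ENNReal.tsum_prod]
  simp [e]

namespace MDP

open scoped Classical in
/-- Expectation of a path functional `w` over the paths from `s` with history `pref`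
whose number of steps satisfies `k`. -/
def pathSum (M : MDP) (𝔖 : List M.S → M.S → M.A) (w : List M.S → ℝ≥0∞) (k : ℕ → Prop)
    (pref : List M.S) (s : M.S) : ℝ≥0∞ :=
  ∑' t : List M.S, if k t.length then M.probAux 𝔖 pref (s :: t) * w (s :: t) else 0

theorem isPath_of_probAux_ne_zero (M : MDP) {𝔖 : List M.S → M.S → M.A} (h𝔖 : M.IsSched 𝔖)
    (t pref : List M.S) (s : M.S) (h : M.probAux 𝔖 pref (s :: t) ≠ 0) : M.IsPath (s :: t) := by
  induction t generalizing pref s with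
  | nil => trivial
  | cons s' t ih =>
    rw [probAux] at h
    exact ⟨⟨_, h𝔖 pref s, pos_iff_ne_zero.mpr (left_ne_zero_of_mul h)⟩,
      ih _ _ (right_ne_zero_of_mul h)⟩

theorem tsum_paths_eq_pathSum (M : MDP) {𝔖 : List M.S → M.S → M.A} (h𝔖 : M.IsSched 𝔖)
    (w : List M.S → ℝ≥0∞) (k : ℕ → Prop) (s : M.S) :
    ∑' π : {π : List M.S | M.IsPath π ∧ π.head? = some s ∧ k π.length},
        M.pathProb 𝔖 (π : List M.S) * w π =
      M.pathSum 𝔖 w (fun m => k (m + 1)) [] s := by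
  classical
  rw [tsum_subtype _ (fun π => M.pathProb 𝔖 π * w π), ENNReal.tsum_list, tsum_eq_single s]
  · rw [Set.indicator_of_notMem (by simp), zero_add, pathSum]
    refine tsum_congr fun t => ?_
    by_cases h : M.probAux 𝔖 [] (s :: t) = 0
    · simp [Set.indicator_apply, pathProb, h]
    · simp [Set.indicator_apply, pathProb, M.isPath_of_probAux_ne_zero h𝔖 _ _ _ h]
  · intro s' hs'
    simp [hs']

theorem pathSum_eq (M : MDP) (𝔖 : List M.S → M.S → M.A) (w : List M.S → ℝ≥0∞)
    (k : ℕ → Prop) [Decidable (k 0)] (pref : List M.S) (s : M.S) :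
    M.pathSum 𝔖 w k pref s = (if k 0 then w [s] else 0) +
      ∑' s', M.P s (𝔖 pref s) s' *
        M.pathSum 𝔖 (fun π => w (s :: π)) (fun m => k (m + 1)) (pref ++ [s]) s' := by
  rw [pathSum, ENNReal.tsum_list]
  simp only [pathSum, ← ENNReal.tsum_mul_left]
  congr 1
  · simp [probAux]
  · refine tsum_congr fun s' => tsum_congr fun t => ?_
    simp [probAux, mul_assoc]

theorem pathSum_congr (M : MDP) (𝔖 : List M.S → M.S → M.A) {w w' : List M.S → ℝ≥0∞}
    {k k' : ℕ → Prop} (hw : ∀ s t, w (s :: t) = w' (s :: t)) (hk : ∀ m, k m ↔ k' m)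
    (pref : List M.S) (s : M.S) :
    M.pathSum 𝔖 w k pref s = M.pathSum 𝔖 w' k' pref s := by
  obtain rfl : k = k' := funext fun m => propext (hk m)
  simp only [pathSum, hw]

theorem pathSum_add (M : MDP) (𝔖 : List M.S → M.S → M.A) (w w' : List M.S → ℝ≥0∞)
    (k : ℕ → Prop) (pref : List M.S) (s : M.S) :
    M.pathSum 𝔖 (fun π => w π + w' π) k pref s =
      M.pathSum 𝔖 w k pref s + M.pathSum 𝔖 w' k pref s := by
  simp only [pathSum, ← ENNReal.tsum_add]
  refine tsum_congr fun t => ?_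
  split_ifs <;> simp [mul_add]

theorem pathSum_const (M : MDP) {𝔖 : List M.S → M.S → M.A} (h𝔖 : M.IsSched 𝔖) (c : ℝ≥0∞)
    (n : ℕ) (pref : List M.S) (s : M.S) :
    M.pathSum 𝔖 (fun _ => c) (· = n) pref s = c := by
  induction n generalizing pref s with
  | zero =>
    rw [pathSum_eq]
    simp [pathSum]
  | succ n ih =>
    rw [pathSum_eq]
    simp only [Nat.add_right_cancel_iff, ih, ENNReal.tsum_mul_right]
    rw [show ∑' s', M.P s (𝔖 pref s) s' = 1 from h𝔖 pref s]
    simp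

theorem pathSum_rewPath_eq_pathSum_lastRew (M : MDP) (rew : M.S → ℝ≥0∞)
    {𝔖 : List M.S → M.S → M.A} (h𝔖 : M.IsSched 𝔖) (n : ℕ) (pref : List M.S) (s : M.S) :
    M.pathSum 𝔖 (rewPath rew) (· = n) pref s = M.pathSum 𝔖 (lastRew rew) (· ≤ n) pref s := by
  induction n generalizing pref s with
  | zero =>
    rw [pathSum_eq, pathSum_eq]
    simp [pathSum, rewPath, lastRew]
  | succ n ih =>
    have hrew (s' : M.S) :
        M.pathSum 𝔖 (fun π => rewPath rew (s :: π)) (fun m => m + 1 = n + 1) (pref ++ [s]) s' =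
          rew s + M.pathSum 𝔖 (rewPath rew) (· = n) (pref ++ [s]) s' := by
      rw [M.pathSum_congr 𝔖 (w' := fun π => rew s + rewPath rew π) (k' := (· = n))
        (by simp [rewPath]) (by simp), pathSum_add, M.pathSum_const h𝔖]
    have hlast (s' : M.S) :
        M.pathSum 𝔖 (fun π => lastRew rew (s :: π)) (fun m => m + 1 ≤ n + 1) (pref ++ [s]) s' =
          M.pathSum 𝔖 (lastRew rew) (· ≤ n) (pref ++ [s]) s' :=
      M.pathSum_congr 𝔖 (by simp [lastRew]) (by simp) _ _
    rw [pathSum_eq, pathSum_eq]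
    simp only [hrew, hlast, ih, mul_add, ENNReal.tsum_add, ENNReal.tsum_mul_right]
    rw [show ∑' s', M.P s (𝔖 pref s) s' = 1 from h𝔖 pref s]
    simp [lastRew]

end MDP

/-- For every scheduler `𝔖`, every `n`, and every state `s`, the
expected reward after exactly `n` steps equals the sum, over all paths of length at
most `n` starting in `s`, of the path probability times the reward of the last
state: `ER⁼ⁿ_𝔖(rew, s) = ∑_{s₀…s_m ∈ Paths^{≤n}(s)} P^𝔖(s₀…s_m) · rew(s_m)`. -/
theorem ERn_eq_tsum_pathsLe_lastRew (M : MDP) (rew : M.S → ℝ≥0∞)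
    (𝔖 : List M.S → M.S → M.A) (h𝔖 : M.IsSched 𝔖) (n : ℕ) (s : M.S) :
    M.ERn rew 𝔖 n s =
      ∑' π : M.PathsLe n s,
        M.pathProb 𝔖 (π : List M.S) * lastRew rew (π : List M.S) := by
  calc
    M.ERn rew 𝔖 n s = M.pathSum 𝔖 (rewPath rew) (fun m => m + 1 = n + 1) [] s :=
      M.tsum_paths_eq_pathSum h𝔖 (rewPath rew) (· = n + 1) s
    _ = M.pathSum 𝔖 (rewPath rew) (· = n) [] s :=
      M.pathSum_congr 𝔖 (fun _ _ => rfl) (by simp) _ _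
    _ = M.pathSum 𝔖 (lastRew rew) (· ≤ n) [] s :=
      M.pathSum_rewPath_eq_pathSum_lastRew rew h𝔖 n [] s
    _ = M.pathSum 𝔖 (lastRew rew) (fun m => m + 1 ≤ n + 1) [] s :=
      M.pathSum_congr 𝔖 (fun _ _ => rfl) (by simp) _ _
    _ = _ := (M.tsum_paths_eq_pathSum h𝔖 (lastRew rew) (· ≤ n + 1) s).symm
end
end

section
/- Let M = (S, Act, P) be an MDP, rew : S → [0,∞] a reward function for M, and Φ_min the min-Bellman operator of M with respect to rew. Let 𝔖 be a memoryless scheduler such that for every state s, the action 𝔖(s) attains the minimum min_{a ∈ Act(s)} ∑_{s'} P(s,a,s')·(lfp Φ_min)(s') (such a scheduler exists since Act(s) is finite and nonempty). Then the least fixed point of Φ_min coincides with the least fixed point of the Bellman operator of the induced Markov chain M(𝔖) with respect to rew: lfp Φ_min = lfp Φ_{M(𝔖)}. -/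
open scoped ENNReal

noncomputable section

namespace MDP

/-- The Bellman operator of the Markov chain induced by the memoryless scheduler `f`
(the min- and max-Bellman operators of the induced chain coincide and are given by
this formula). -/
def mcBellman (M : MDP) (rew : M.S → ℝ≥0∞) (f : M.S → M.A) (v : M.S → ℝ≥0∞) :
    M.S → ℝ≥0∞ :=
  fun s => rew s + ∑' s', M.P s (f s) s' * v s'

end MDP

theorem lfpOf_le {α : Type*} [CompleteLattice α] {Φ : α → α} {v : α} (h : Φ v ≤ v) :
    lfpOf Φ ≤ v :=
  sInf_le h

theorem map_lfpOf_le {α : Type*} [CompleteLattice α] {Φ : α → α} (hΦ : Monotone Φ) :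
    Φ (lfpOf Φ) ≤ lfpOf Φ :=
  le_sInf fun _ hv => (hΦ (lfpOf_le hv)).trans hv

theorem lfpOf_mono {α : Type*} [CompleteLattice α] {Φ Ψ : α → α} (h : Φ ≤ Ψ) :
    lfpOf Φ ≤ lfpOf Ψ :=
  sInf_le_sInf fun v hv => (h v).trans hv

namespace MDP

theorem bellmanMin_mono (M : MDP) (rew : M.S → ℝ≥0∞) : Monotone (M.bellmanMin rew) :=
  fun _ _ h _ => add_le_add_right
    (iInf_mono fun _ => ENNReal.tsum_le_tsum fun s' => mul_le_mul_right (h s') _) _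

theorem bellmanMin_le_mcBellman (M : MDP) (rew : M.S → ℝ≥0∞) {f : M.S → M.A}
    (hf : ∀ s, f s ∈ M.Act s) : M.bellmanMin rew ≤ M.mcBellman rew f :=
  fun _ s => add_le_add_right (iInf_le _ (⟨f s, hf s⟩ : M.Act s)) _

end MDP

/-- Let `f` be a memoryless scheduler such that for every state `s`
the action `f s` attains the minimum `min_{a ∈ Act(s)} ∑_{s'} P(s,a,s') · (lfp Φmin)(s')`.
Then the least fixed point of the min-Bellman operator of `M` coincides with the least
fixed point of the Bellman operator of the induced Markov chain `M(f)`: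
`lfp Φmin = lfp Φ_{M(f)}`. -/
theorem lfp_bellmanMin_eq_lfp_mcBellman (M : MDP) (rew : M.S → ℝ≥0∞)
    (f : M.S → M.A) (hf : ∀ s, f s ∈ M.Act s)
    (hopt : ∀ s, (∑' s', M.P s (f s) s' * lfpOf (M.bellmanMin rew) s') =
      ⨅ a : M.Act s, ∑' s', M.P s a.1 s' * lfpOf (M.bellmanMin rew) s') :
    lfpOf (M.bellmanMin rew) = lfpOf (M.mcBellman rew f) := by
  refine le_antisymm (lfpOf_mono (M.bellmanMin_le_mcBellman rew hf)) (lfpOf_le ?_)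
  have h : M.mcBellman rew f (lfpOf (M.bellmanMin rew)) =
      M.bellmanMin rew (lfpOf (M.bellmanMin rew)) :=
    funext fun s => congrArg (rew s + ·) (hopt s)
  exact h.trans_le (map_lfpOf_le (M.bellmanMin_mono rew))
end
end
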